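/- arXiv:2511.18432 — 2 statements merged into one kernel-verified Lean document; each statement's English description precedes it below -/
import Mathlib

section
/- Under Conditions 1–3, for all u, v with 0 < u, v < 1, the covariance of the standardized weighted edge-count process converges: lim_{n→∞} Cov(Z_out,w([nu]), Z_out,w([nv])) = (u∧v)(1 − (u∨v)) / ((u∨v)(1 − (u∧v))), where u∧v = min(u,v), u∨v = max(u,v), and [x] denotes the integer part of x. -/
open scoped BigOperators Classical

noncomputable section

namespace CPD

/-- Nodes: `n` individuals, each with `ℓ` repeated measurements. -/
abbrev Node (n ℓ : ℕ) := Fin n × Fin ℓ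

/-- The (unordered) pair of individuals joined by an edge. -/
def indPair {n ℓ : ℕ} (e : Sym2 (Node n ℓ)) : Sym2 (Fin n) := Sym2.map Prod.fst e

/-- Between-individual edges of the graph `Gr`. -/
def Gout {n ℓ : ℕ} (Gr : Finset (Sym2 (Node n ℓ))) : Finset (Sym2 (Node n ℓ)) :=
  Gr.filter fun e => ¬ (indPair e).IsDiag

/-- Within-individual edges of the graph `Gr`. -/
def Gin {n ℓ : ℕ} (Gr : Finset (Sym2 (Node n ℓ))) : Finset (Sym2 (Node n ℓ)) :=
  Gr.filter fun e => (indPair e).IsDiag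

/-- `D Gr u v`: the number of edges of `Gr` between individual `u` and individual `v`
(for `u = v`, the number of within-individual edges of individual `u`). -/
def D {n ℓ : ℕ} (Gr : Finset (Sym2 (Node n ℓ))) (u v : Fin n) : ℕ :=
  (Gr.filter fun e => indPair e = s(u, v)).card

/-- `Ddeg Gr u = ∑_{v ≠ u} D Gr u v`. -/
def Ddeg {n ℓ : ℕ} (Gr : Finset (Sym2 (Node n ℓ))) (u : Fin n) : ℕ :=
  ∑ v ∈ Finset.univ.filter fun v => v ≠ u, D Gr u v

/-- Number of between-individual edges both of whose endpoints belong to individuals whose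
permuted label (in `{1, …, n}`) is `≤ t`. -/
def Rout1 {n ℓ : ℕ} (Gr : Finset (Sym2 (Node n ℓ))) (t : ℕ) (σ : Equiv.Perm (Fin n)) : ℕ :=
  ((Gout Gr).filter fun e => ∀ x ∈ e, ((σ x.1 : ℕ) + 1 ≤ t)).card

/-- Number of between-individual edges both of whose endpoints belong to individuals whose
permuted label is `> t`. -/
def Rout2 {n ℓ : ℕ} (Gr : Finset (Sym2 (Node n ℓ))) (t : ℕ) (σ : Equiv.Perm (Fin n)) : ℕ :=
  ((Gout Gr).filter fun e => ∀ x ∈ e, (t ≤ (σ x.1 : ℕ))).card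

/-- Number of within-individual edges both of whose endpoints belong to individuals whose
permuted label is `≤ t`. -/
def Rin1 {n ℓ : ℕ} (Gr : Finset (Sym2 (Node n ℓ))) (t : ℕ) (σ : Equiv.Perm (Fin n)) : ℕ :=
  ((Gin Gr).filter fun e => ∀ x ∈ e, ((σ x.1 : ℕ) + 1 ≤ t)).card

/-- Expectation under the permutation null distribution (uniform over the `n!` permutations of
the individual labels). -/
def pexp {n : ℕ} (f : Equiv.Perm (Fin n) → ℝ) : ℝ :=
  (∑ σ : Equiv.Perm (Fin n), f σ) / (Nat.factorial n)

/-- Covariance under the permutation null distribution. -/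
def pcov {n : ℕ} (f g : Equiv.Perm (Fin n) → ℝ) : ℝ :=
  pexp fun σ => (f σ - pexp f) * (g σ - pexp g)

/-- Variance under the permutation null distribution. -/
def pvar {n : ℕ} (f : Equiv.Perm (Fin n) → ℝ) : ℝ := pcov f f

/-- The weighted edge-count statistic
`R_out,w(t) = ((n−t−1)·R_out,1(t) + (t−1)·R_out,2(t))/(n−2)`. -/
def Routw {n ℓ : ℕ} (Gr : Finset (Sym2 (Node n ℓ))) (t : ℕ) (σ : Equiv.Perm (Fin n)) : ℝ :=
  (((n : ℝ) - t - 1) * (Rout1 Gr t σ : ℝ) + ((t : ℝ) - 1) * (Rout2 Gr t σ : ℝ)) / ((n : ℝ) - 2)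

/-- The difference edge-count statistic `R_out,d(t) = R_out,1(t) − R_out,2(t)`. -/
def Routd {n ℓ : ℕ} (Gr : Finset (Sym2 (Node n ℓ))) (t : ℕ) (σ : Equiv.Perm (Fin n)) : ℝ :=
  (Rout1 Gr t σ : ℝ) - (Rout2 Gr t σ : ℝ)

/-- Standardized weighted between-individual statistic `Z_out,w(t)`. -/
def Zoutw {n ℓ : ℕ} (Gr : Finset (Sym2 (Node n ℓ))) (t : ℕ) (σ : Equiv.Perm (Fin n)) : ℝ :=
  (Routw Gr t σ - pexp (Routw Gr t)) / Real.sqrt (pvar (Routw Gr t))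

/-- Standardized difference statistic `Z_out,d(t)`. -/
def Zoutd {n ℓ : ℕ} (Gr : Finset (Sym2 (Node n ℓ))) (t : ℕ) (σ : Equiv.Perm (Fin n)) : ℝ :=
  (Routd Gr t σ - pexp (Routd Gr t)) / Real.sqrt (pvar (Routd Gr t))

/-- Standardized within-individual statistic `Z_in(t)`. -/
def Zin {n ℓ : ℕ} (Gr : Finset (Sym2 (Node n ℓ))) (t : ℕ) (σ : Equiv.Perm (Fin n)) : ℝ :=
  ((Rin1 Gr t σ : ℝ) - pexp (fun τ => (Rin1 Gr t τ : ℝ))) /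
    Real.sqrt (pvar (fun τ => (Rin1 Gr t τ : ℝ)))

/-- The constant
`ϱ = (Σ_u D_uu·D_u − (2/n)|G_in||G_out|) / sqrt((Σ_u D_u² − 4|G_out|²/n)(Σ_u D_uu² − |G_in|²/n))`. -/
def varrho {n ℓ : ℕ} (Gr : Finset (Sym2 (Node n ℓ))) : ℝ :=
  ((∑ u : Fin n, (D Gr u u : ℝ) * (Ddeg Gr u : ℝ)) -
      2 / (n : ℝ) * ((Gin Gr).card : ℝ) * ((Gout Gr).card : ℝ)) /
    Real.sqrt (((∑ u : Fin n, (Ddeg Gr u : ℝ) ^ 2) - 4 * ((Gout Gr).card : ℝ) ^ 2 / (n : ℝ)) *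
      ((∑ u : Fin n, (D Gr u u : ℝ) ^ 2) - ((Gin Gr).card : ℝ) ^ 2 / (n : ℝ)))


open Asymptotics

/-- `e'` shares an individual with `e`. -/
def touches {n ℓ : ℕ} (e e' : Sym2 (Node n ℓ)) : Prop := ∃ x ∈ e', ∃ y ∈ e, x.1 = y.1

/-- The neighborhood `A_e` of an edge `e`: for a between-individual edge `e` joining individuals
`u, v`, the between-individual edges with an endpoint in `C_u ∪ C_v`; for a within-individual edge
`e` of individual `u`, the between-individual edges with an endpoint in `C_u` together with the
within-individual edges of individual `u`. -/
def Ae {n ℓ : ℕ} (Gr : Finset (Sym2 (Node n ℓ))) (e : Sym2 (Node n ℓ)) :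
    Finset (Sym2 (Node n ℓ)) :=
  if (indPair e).IsDiag then Gr.filter fun e' => touches e e'
  else (Gout Gr).filter fun e' => touches e e'

/-- `B_e = ∪_{ẽ ∈ A_e} A_ẽ`. -/
def Be {n ℓ : ℕ} (Gr : Finset (Sym2 (Node n ℓ))) (e : Sym2 (Node n ℓ)) :
    Finset (Sym2 (Node n ℓ)) :=
  (Ae Gr e).biUnion fun e' => Ae Gr e'

/-- `a` and `b` are of the same (exact) order. -/
def SameOrder (a b : ℕ → ℝ) : Prop :=
  ∃ c C : ℝ, 0 < c ∧ ∀ᶠ n in Filter.atTop, c * b n ≤ a n ∧ a n ≤ C * b n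

/-- Condition 1: `|G_out| = O(n)` and `|G_in| = O(n)` (exact order `n`). -/
def Cond1 (ℓ : ℕ) (Gr : ∀ n : ℕ, Finset (Sym2 (Node n ℓ))) : Prop :=
  SameOrder (fun n => ((Gout (Gr n)).card : ℝ)) (fun n => (n : ℝ)) ∧
  SameOrder (fun n => ((Gin (Gr n)).card : ℝ)) (fun n => (n : ℝ))

/-- Condition 2: `Σ_u D_u² − 4|G_out|²/n = O(n)` and `Σ_u D_uu² − |G_in|²/n = O(n)`
(exact order `n`). -/
def Cond2 (ℓ : ℕ) (Gr : ∀ n : ℕ, Finset (Sym2 (Node n ℓ))) : Prop :=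
  SameOrder
    (fun n => (∑ u : Fin n, (Ddeg (Gr n) u : ℝ) ^ 2) - 4 * ((Gout (Gr n)).card : ℝ) ^ 2 / (n : ℝ))
    (fun n => (n : ℝ)) ∧
  SameOrder
    (fun n => (∑ u : Fin n, (D (Gr n) u u : ℝ) ^ 2) - ((Gin (Gr n)).card : ℝ) ^ 2 / (n : ℝ))
    (fun n => (n : ℝ))

/-- Condition 3: `Σ_{e ∈ G_out} |A_out,e|·|B_out,e| = o(n^{1.5})`. -/
def Cond3 (ℓ : ℕ) (Gr : ∀ n : ℕ, Finset (Sym2 (Node n ℓ))) : Prop :=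
  (fun n : ℕ => ∑ e ∈ Gout (Gr n), ((Ae (Gr n) e).card : ℝ) * ((Be (Gr n) e).card : ℝ))
    =o[Filter.atTop] fun n : ℕ => (n : ℝ) ^ (1.5 : ℝ)

section PermutationSums

variable {α : Type*} [DecidableEq α]

lemma exists_perm_pair {a b a' b' : α} (h : a ≠ b) (h' : a' ≠ b') :
    ∃ τ : Equiv.Perm α, τ a = a' ∧ τ b = b' := by
  refine ⟨Equiv.swap (Equiv.swap a a' b) b' * Equiv.swap a a', ?_, ?_⟩
  · rw [Equiv.Perm.mul_apply, Equiv.swap_apply_left, Equiv.swap_apply_of_ne_of_ne _ h']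
    intro hc
    have := congrArg (Equiv.swap a a') hc
    simp at this
    exact h this
  · simp

variable [Fintype α]

/-- A symmetric kernel with zero diagonal and zero row sums. -/
structure IsCentered (K : α → α → ℝ) : Prop where
  symm : ∀ i j, K i j = K j i
  diag : ∀ i, K i i = 0
  row : ∀ i, ∑ j, K i j = 0

/-- Unnormalized mixed moment of two kernels along a uniformly random permutation. -/
def permMoment (K L : α → α → ℝ) (a b c d : α) : ℝ :=
  ∑ σ : Equiv.Perm α, K (σ a) (σ b) * L (σ c) (σ d)

variable {K L : α → α → ℝ}

lemma permMoment_map (τ : Equiv.Perm α) (a b c d : α) :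
    permMoment K L (τ a) (τ b) (τ c) (τ d) = permMoment K L a b c d :=
  Fintype.sum_equiv (Equiv.mulRight τ) _ _ fun σ => by simp

lemma permMoment_swap_left (hK : IsCentered K) (a b c d : α) :
    permMoment K L a b c d = permMoment K L b a c d :=
  Finset.sum_congr rfl fun σ _ => by rw [hK.symm]

lemma permMoment_swap_right (hL : IsCentered L) (a b c d : α) :
    permMoment K L a b c d = permMoment K L a b d c :=
  Finset.sum_congr rfl fun σ _ => by rw [hL.symm (σ c)]

lemma permMoment_diag (hK : IsCentered K) (a c d : α) : permMoment K L a a c d = 0 :=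
  Finset.sum_eq_zero fun σ _ => by rw [hK.diag, zero_mul]

lemma sum_permMoment (hK : IsCentered K) (a c d : α) : ∑ b, permMoment K L a b c d = 0 := by
  unfold permMoment
  rw [Finset.sum_comm]
  refine Finset.sum_eq_zero fun σ _ => ?_
  rw [← Finset.sum_mul, Equiv.sum_comp σ (fun j => K (σ a) j), hK.row, zero_mul]

lemma permMoment_same (hK : IsCentered K) {a b : α} (h : a ≠ b) :
    ((Fintype.card α : ℝ) * (Fintype.card α - 1)) * permMoment K L a b a b =
      (Fintype.card α).factorial * ∑ i, ∑ j, K i j * L i j := by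
  have h1 : ∑ i, ∑ j, permMoment K L i j i j =
      (Fintype.card α).factorial * ∑ i, ∑ j, K i j * L i j := by
    have : ∀ σ : Equiv.Perm α, ∑ i, ∑ j, K (σ i) (σ j) * L (σ i) (σ j) =
        ∑ i, ∑ j, K i j * L i j := fun σ => by
      rw [← Equiv.sum_comp σ (fun i => ∑ j, K i j * L i j)]
      exact Finset.sum_congr rfl fun i _ =>
        Equiv.sum_comp σ (fun j => K (σ i) j * L (σ i) j)
    simp only [permMoment]
    rw [Finset.sum_congr rfl fun i _ => Finset.sum_comm, Finset.sum_comm,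
      Finset.sum_congr rfl fun σ _ => this σ]
    simp [Fintype.card_perm]
  have h2 : ∀ i j, permMoment K L i j i j =
      (1 - if i = j then 1 else 0) * permMoment K L a b a b := by
    intro i j
    split_ifs with hij
    · rw [hij, permMoment_diag hK]; ring
    · obtain ⟨τ, rfl, rfl⟩ := exists_perm_pair h hij
      rw [permMoment_map]; ring
  rw [← h1]
  rw [Finset.sum_congr rfl fun i _ => Finset.sum_congr rfl fun j _ => h2 i j]
  simp only [← Finset.sum_mul, Finset.sum_sub_distrib, Finset.sum_ite_eq, Finset.mem_univ,
    if_true, Finset.sum_const, Finset.card_univ, nsmul_eq_mul, mul_one]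
  ring

/-- If a function with zero total is constant outside a finite set, that constant is determined
by the values on the set. -/
lemma card_sub_mul_add_sum_eq_zero (f : α → ℝ) (s : Finset α) (x : ℝ) (hf : ∑ b, f b = 0)
    (hx : ∀ b ∉ s, f b = x) : ((Fintype.card α : ℝ) - s.card) * x + ∑ b ∈ s, f b = 0 := by
  rw [← hf, ← Finset.sum_compl_add_sum s f,
    Finset.sum_congr rfl fun b hb => hx b (Finset.mem_compl.1 hb), Finset.sum_const,
    Finset.card_compl, nsmul_eq_mul, Nat.cast_sub (Finset.card_le_univ s)]

lemma permMoment_replace {a b b' c d : α} (ha : b ≠ a) (hc : b ≠ c) (hd : b ≠ d)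
    (ha' : b' ≠ a) (hc' : b' ≠ c) (hd' : b' ≠ d) :
    permMoment K L a b' c d = permMoment K L a b c d := by
  have := permMoment_map (K := K) (L := L) (Equiv.swap b b') a b c d
  rwa [Equiv.swap_apply_of_ne_of_ne ha.symm ha'.symm, Equiv.swap_apply_left,
    Equiv.swap_apply_of_ne_of_ne hc.symm hc'.symm,
    Equiv.swap_apply_of_ne_of_ne hd.symm hd'.symm] at this

lemma permMoment_share (hK : IsCentered K) {a b d : α} (hab : a ≠ b) (had : a ≠ d)
    (hbd : b ≠ d) :
    ((Fintype.card α : ℝ) - 2) * permMoment K L a b a d = - permMoment K L a d a d := by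
  have := card_sub_mul_add_sum_eq_zero (fun b' => permMoment K L a b' a d) {a, d}
    (permMoment K L a b a d) (sum_permMoment hK a a d) (fun b' hb' => by
      simp only [Finset.mem_insert, Finset.mem_singleton, not_or] at hb'
      exact permMoment_replace hab.symm hab.symm hbd hb'.1 hb'.1 hb'.2)
  rw [Finset.card_pair had, Finset.sum_pair had, permMoment_diag hK] at this
  push_cast at this
  linarith

lemma permMoment_disjoint (hK : IsCentered K) {a b c d : α} (hab : a ≠ b) (hac : a ≠ c)
    (had : a ≠ d) (hbc : b ≠ c) (hbd : b ≠ d) (hcd : c ≠ d) :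
    ((Fintype.card α : ℝ) - 3) * permMoment K L a b c d =
      - permMoment K L a c c d - permMoment K L a d c d := by
  have := card_sub_mul_add_sum_eq_zero (fun b' => permMoment K L a b' c d) {a, c, d}
    (permMoment K L a b c d) (sum_permMoment hK a c d) (fun b' hb' => by
      simp only [Finset.mem_insert, Finset.mem_singleton, not_or] at hb'
      exact permMoment_replace hab.symm hbc hbd hb'.1 hb'.2.1 hb'.2.2)
  rw [Finset.card_eq_three.2 ⟨a, c, d, hac, had, hcd, rfl⟩, Finset.sum_insert (by simp [hac, had]),
    Finset.sum_pair hcd, permMoment_diag hK] at this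
  push_cast at this
  linarith

/-- The Kronecker delta. -/
def kd (i j : α) : ℝ := if i = j then 1 else 0

lemma permMoment_eq (hK : IsCentered K) (hL : IsCentered L) {f : ℝ}
    (hf : ∀ a b, a ≠ b → permMoment K L a b a b = f) {a b c d : α} (hab : a ≠ b) (hcd : c ≠ d) :
    (((Fintype.card α : ℝ) - 2) * (Fintype.card α - 3)) * permMoment K L a b c d =
      f * (2 - (Fintype.card α - 1) * (kd a c + kd a d + kd b c + kd b d) +
        (Fintype.card α - 1) * (Fintype.card α - 2) * (kd a c * kd b d + kd a d * kd b c)) := by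
  set N : ℝ := (Fintype.card α : ℝ)
  have share : ∀ a b d : α, a ≠ b → a ≠ d → b ≠ d → (N - 2) * permMoment K L a b a d = - f := by
    intro a b d h1 h2 h3
    rw [permMoment_share hK h1 h2 h3, hf a d h2]
  by_cases hac : a = c
  · subst hac
    by_cases hbd : b = d
    · subst hbd
      rw [hf a b hab]
      simp only [kd, if_true, hab, hab.symm, if_false]; ring
    · have := share a b d hab hcd hbd
      simp only [kd, if_true, hab.symm, hcd, hbd, if_false]
      linear_combination (N - 3) * this
  by_cases had : a = d
  · subst had
    rw [permMoment_swap_right hL]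
    by_cases hbc : b = c
    · subst hbc
      rw [hf a b hab]
      simp only [kd, if_true, hab, hab.symm, if_false]; ring
    · have := share a b c hab hac hbc
      simp only [kd, if_true, hab.symm, hac, hbc, if_false]
      linear_combination (N - 3) * this
  by_cases hbc : b = c
  · subst hbc
    have := share b a d hab.symm hcd had
    rw [permMoment_swap_left hK]
    simp only [kd, if_true, hab, had, hcd, if_false]
    linear_combination (N - 3) * this
  by_cases hbd : b = d
  · subst hbd
    have := share b a c hab.symm hbc hac
    rw [permMoment_swap_left hK, permMoment_swap_right hL]
    simp only [kd, if_true, hab, hac, hbc, if_false]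
    linear_combination (N - 3) * this
  have h0 := permMoment_disjoint (L := L) hK hab hac had hbc hbd hcd
  have h1 := share c a d (Ne.symm hac) hcd had
  have h2 := share d a c (Ne.symm had) hcd.symm hac
  rw [permMoment_swap_left hK] at h1 h2
  rw [permMoment_swap_right hL] at h2
  simp only [kd, hac, had, hbc, hbd, if_false]
  linear_combination (N - 2) * h0 - h1 - h2

lemma sum_mul_kd (f : α → ℝ) (i : α) : ∑ j, f j * kd i j = f i := by
  simp [kd]

/-- Exact second moment of a quadratic permutation statistic with centered kernels. -/
lemma sum_perm_quadratic (hK : IsCentered K) (hL : IsCentered L) {A : α → α → ℝ}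
    (hsymm : ∀ i j, A i j = A j i) (hdiag : ∀ i, A i i = 0) (hcard : 4 ≤ Fintype.card α) :
    (((Fintype.card α : ℝ) * (Fintype.card α - 1) * (Fintype.card α - 2) * (Fintype.card α - 3)) *
      ∑ σ : Equiv.Perm α, (∑ a, ∑ b, A a b * K (σ a) (σ b)) * ∑ c, ∑ d, A c d * L (σ c) (σ d)) =
    ((Fintype.card α).factorial * ∑ i, ∑ j, K i j * L i j) *
      (2 * (∑ a, ∑ b, A a b) ^ 2 - 4 * (Fintype.card α - 1) * ∑ a, (∑ b, A a b) ^ 2 +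
        2 * ((Fintype.card α - 1) * (Fintype.card α - 2)) * ∑ a, ∑ b, A a b ^ 2) := by
  have hN : (4 : ℝ) ≤ Fintype.card α := by exact_mod_cast hcard
  set N : ℝ := (Fintype.card α : ℝ)
  set S : ℝ := (Fintype.card α).factorial * ∑ i, ∑ j, K i j * L i j
  have hN1 : N * (N - 1) ≠ 0 := by apply ne_of_gt; nlinarith
  have hf : ∀ a b : α, a ≠ b → permMoment K L a b a b = S / (N * (N - 1)) := by
    intro a b h
    rw [eq_div_iff hN1, mul_comm]
    exact permMoment_same hK h
  have hterm : ∀ a b c d, N * (N - 1) * (N - 2) * (N - 3) *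
      (A a b * A c d * permMoment K L a b c d) = S * (A a b * A c d *
      (2 - (N - 1) * (kd a c + kd a d + kd b c + kd b d) +
        (N - 1) * (N - 2) * (kd a c * kd b d + kd a d * kd b c))) := by
    intro a b c d
    by_cases hab : a = b
    · rw [hab, hdiag]; ring
    by_cases hcd : c = d
    · rw [hcd, hdiag]; ring
    have := permMoment_eq hK hL hf hab hcd
    have h3 : S / (N * (N - 1)) * (N * (N - 1)) = S := div_mul_cancel₀ _ hN1
    rw [← h3]
    linear_combination (N * (N - 1) * A a b * A c d) * this
  have hexp : ∑ σ : Equiv.Perm α, (∑ a, ∑ b, A a b * K (σ a) (σ b)) *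
      ∑ c, ∑ d, A c d * L (σ c) (σ d) =
      ∑ a, ∑ b, ∑ c, ∑ d, A a b * A c d * permMoment K L a b c d := by
    have hσ : ∀ σ : Equiv.Perm α, (∑ a, ∑ b, A a b * K (σ a) (σ b)) *
        ∑ c, ∑ d, A c d * L (σ c) (σ d) =
        ∑ a, ∑ b, ∑ c, ∑ d, A a b * A c d * (K (σ a) (σ b) * L (σ c) (σ d)) := by
      intro σ
      rw [Finset.sum_mul]
      refine Finset.sum_congr rfl fun a _ => ?_
      rw [Finset.sum_mul]
      refine Finset.sum_congr rfl fun b _ => ?_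
      rw [Finset.mul_sum]
      refine Finset.sum_congr rfl fun c _ => ?_
      rw [Finset.mul_sum]
      exact Finset.sum_congr rfl fun d _ => by ring
    rw [Finset.sum_congr rfl fun σ _ => hσ σ, Finset.sum_comm]
    refine Finset.sum_congr rfl fun a _ => ?_
    rw [Finset.sum_comm]
    refine Finset.sum_congr rfl fun b _ => ?_
    rw [Finset.sum_comm]
    refine Finset.sum_congr rfl fun c _ => ?_
    rw [Finset.sum_comm]
    refine Finset.sum_congr rfl fun d _ => ?_
    rw [permMoment, Finset.mul_sum]
  have hin : ∀ a b, ∑ c, ∑ d, A a b * A c d *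
      (2 - (N - 1) * (kd a c + kd a d + kd b c + kd b d) +
        (N - 1) * (N - 2) * (kd a c * kd b d + kd a d * kd b c)) =
      A a b * (2 * (∑ c, ∑ d, A c d) - (N - 1) * (2 * (∑ d, A a d) + 2 * ∑ d, A b d)
        + (N - 1) * (N - 2) * (2 * A a b)) := by
    intro a b
    have hr : ∀ i, ∑ c, ∑ d, A c d * kd i c = ∑ d, A i d := fun i => by
      rw [Finset.sum_comm]; simp only [sum_mul_kd]
    have hc : ∀ i, ∑ c, ∑ d, A c d * kd i d = ∑ d, A i d := fun i => by
      simp only [sum_mul_kd]; exact Finset.sum_congr rfl fun d _ => hsymm d i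
    have hm : ∀ i j, ∑ c, ∑ d, A c d * kd j d * kd i c = A i j := fun i j => by
      simp only [← Finset.sum_mul, sum_mul_kd]
    have : ∀ c d, A a b * A c d *
      (2 - (N - 1) * (kd a c + kd a d + kd b c + kd b d) +
        (N - 1) * (N - 2) * (kd a c * kd b d + kd a d * kd b c)) =
        A a b * (2 * A c d - (N - 1) * (A c d * kd a c + A c d * kd a d + A c d * kd b c
          + A c d * kd b d) + (N - 1) * (N - 2) * (A c d * kd b d * kd a c +
            A c d * kd a d * kd b c)) := fun c d => by ring
    simp only [this, ← Finset.mul_sum, Finset.sum_add_distrib, Finset.sum_sub_distrib, hr, hc, hm]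
    rw [hsymm b a]; ring
  rw [hexp]
  simp only [Finset.mul_sum (a := N * (N - 1) * (N - 2) * (N - 3)), hterm]
  simp only [← Finset.mul_sum (a := S), hin]
  congr 1
  have e1 : ∑ a, ∑ b, A a b * ∑ d, A a d = ∑ a, (∑ b, A a b) ^ 2 := by
    simp only [← Finset.sum_mul, sq]
  have e2 : ∑ a, ∑ b, A a b * ∑ d, A b d = ∑ a, (∑ b, A a b) ^ 2 := by
    rw [Finset.sum_comm, ← e1]
    exact Finset.sum_congr rfl fun a _ => Finset.sum_congr rfl fun b _ => by rw [hsymm]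
  have e3 : ∀ a b, A a b * (2 * (∑ c, ∑ d, A c d) - (N - 1) * (2 * (∑ d, A a d) + 2 * ∑ d, A b d)
        + (N - 1) * (N - 2) * (2 * A a b)) = A a b * (2 * (∑ c, ∑ d, A c d)) -
        2 * (N - 1) * (A a b * ∑ d, A a d) - 2 * (N - 1) * (A a b * ∑ d, A b d) +
        2 * ((N - 1) * (N - 2)) * A a b ^ 2 := fun a b => by ring
  simp only [e3, Finset.sum_add_distrib, Finset.sum_sub_distrib, ← Finset.mul_sum,
    ← Finset.sum_mul, e2]
  have e1' : ∑ a, (∑ b, A a b) * ∑ d, A a d = ∑ a, (∑ b, A a b) ^ 2 := by simp only [sq]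
  rw [e1']
  ring

lemma sum_perm_linear (hK : IsCentered K) {a b : α} (hab : a ≠ b) :
    ∑ σ : Equiv.Perm α, K (σ a) (σ b) = 0 := by
  have hr : ∑ b', ∑ σ : Equiv.Perm α, K (σ a) (σ b') = 0 := by
    rw [Finset.sum_comm]
    exact Finset.sum_eq_zero fun σ _ => by rw [Equiv.sum_comp σ (fun j => K (σ a) j), hK.row]
  have := card_sub_mul_add_sum_eq_zero (fun b' => ∑ σ : Equiv.Perm α, K (σ a) (σ b')) {a}
    (∑ σ : Equiv.Perm α, K (σ a) (σ b)) hr (fun b' hb' => by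
      obtain ⟨τ, h1, h2⟩ := exists_perm_pair (Ne.symm (Finset.notMem_singleton.1 hb')) hab
      refine (Fintype.sum_equiv (Equiv.mulRight τ) _ _ fun σ => ?_).symm
      simp [h1, h2])
  simp only [Finset.card_singleton, Finset.sum_singleton, hK.diag, Finset.sum_const_zero,
    add_zero, mul_eq_zero, Nat.cast_one, sub_eq_zero] at this
  refine this.resolve_left fun h => ?_
  have : Nontrivial α := ⟨a, b, hab⟩
  have := Fintype.one_lt_card (α := α)
  have : Fintype.card α = 1 := by exact_mod_cast h
  omega

end PermutationSums

section WeightedKernel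

/-- Indicator that the label `i` is among the first `t`. -/
def early {n : ℕ} (t : ℕ) (i : Fin n) : ℝ := if (i : ℕ) < t then 1 else 0

lemma sum_early {n t : ℕ} (ht : t ≤ n) : ∑ i : Fin n, early t i = t := by
  simp only [early, Finset.sum_boole]
  rw [Fin.card_filter_val_lt, min_eq_right ht]

lemma early_mul_early {n s t : ℕ} (hst : s ≤ t) (i : Fin n) :
    early s i * early t i = early s i := by
  unfold early
  split_ifs <;> first | omega | simp

/-- Off-diagonal values of the centered weighted kernel. -/
def wform {n : ℕ} (t : ℕ) (i j : Fin n) : ℝ :=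
  early t i * early t j - ((t : ℝ) - 1) / ((n : ℝ) - 2) * (early t i + early t j) +
    (t : ℝ) * ((t : ℝ) - 1) / (((n : ℝ) - 1) * ((n : ℝ) - 2))

/-- The centered kernel of the weighted edge-count statistic. -/
def wker {n : ℕ} (t : ℕ) (i j : Fin n) : ℝ := if i = j then 0 else wform t i j

lemma wker_eq {n : ℕ} (t : ℕ) (i j : Fin n) :
    wker t i j = wform t i j - wform t i j * kd i j := by
  unfold wker kd; split_ifs <;> ring

lemma isCentered_wker {n t : ℕ} (hn : 4 ≤ n) (ht : t ≤ n) :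
    IsCentered (wker t : Fin n → Fin n → ℝ) where
  symm i j := by
    unfold wker wform
    simp only [eq_comm (a := i)]
    split_ifs <;> ring
  diag i := by simp [wker]
  row i := by
    have hn' : (4 : ℝ) ≤ n := by exact_mod_cast hn
    have h1 : (n : ℝ) - 1 ≠ 0 := by linarith
    have h2 : (n : ℝ) - 2 ≠ 0 := by linarith
    have hx := early_mul_early (le_refl t) i
    simp only [wker_eq, Finset.sum_sub_distrib, sum_mul_kd]
    simp only [wform, Finset.sum_add_distrib, Finset.sum_sub_distrib, ← Finset.mul_sum,
      sum_early ht, hx, Finset.sum_const, Finset.card_univ, Fintype.card_fin, nsmul_eq_mul]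
    field_simp
    ring

lemma sum_wker_mul_wker {n s t : ℕ} (hn : 4 ≤ n) (hst : s ≤ t) (ht : t ≤ n) :
    ∑ i : Fin n, ∑ j, wker s i j * wker t i j =
      (s : ℝ) * (s - 1) * (n - t) * (n - t - 1) / ((n - 1) * (n - 2)) := by
  have hn' : (4 : ℝ) ≤ n := by exact_mod_cast hn
  have h1 : (n : ℝ) - 1 ≠ 0 := by linarith
  have h2 : (n : ℝ) - 2 ≠ 0 := by linarith
  have hK := isCentered_wker hn (hst.trans ht)
  have hcol : ∀ j, ∑ i : Fin n, wker s i j = 0 := fun j => by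
    simp only [fun i => hK.symm i j, hK.row]
  have hprod : ∀ i j : Fin n, wker s i j * wker t i j =
      wker s i j * (early t i * early t j)
        - wker s i j * (((t : ℝ) - 1) / ((n : ℝ) - 2) * early t i)
        - wker s i j * (((t : ℝ) - 1) / ((n : ℝ) - 2) * early t j)
        + wker s i j * ((t : ℝ) * ((t : ℝ) - 1) / (((n : ℝ) - 1) * ((n : ℝ) - 2))) := by
    intro i j
    by_cases h : i = j
    · rw [h, hK.diag]; ring
    · rw [show wker t i j = wform t i j from if_neg h, wform]; ring
  have hz : ∑ i : Fin n, ∑ j, wker s i j * (((t : ℝ) - 1) / ((n : ℝ) - 2) * early t j) = 0 := by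
    rw [Finset.sum_comm]
    simp only [← Finset.sum_mul, hcol, zero_mul, Finset.sum_const_zero]
  simp only [hprod, Finset.sum_add_distrib, Finset.sum_sub_distrib, hz]
  simp only [← Finset.sum_mul, hK.row, zero_mul, Finset.sum_const_zero, sub_zero, add_zero]
  have hfull : ∀ i j : Fin n, wker s i j * (early t i * early t j) =
      (early s i * early s j - ((s : ℝ) - 1) / ((n : ℝ) - 2) * (early s i * early t j)
        - ((s : ℝ) - 1) / ((n : ℝ) - 2) * (early t i * early s j)
        + (s : ℝ) * ((s : ℝ) - 1) / (((n : ℝ) - 1) * ((n : ℝ) - 2)) * (early t i * early t j))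
        - (early s i * early s j - ((s : ℝ) - 1) / ((n : ℝ) - 2) * (early s i * early t j)
        - ((s : ℝ) - 1) / ((n : ℝ) - 2) * (early t i * early s j)
        + (s : ℝ) * ((s : ℝ) - 1) / (((n : ℝ) - 1) * ((n : ℝ) - 2)) * (early t i * early t j))
          * kd i j := by
    intro i j
    have hi := early_mul_early hst i
    have hj := early_mul_early hst j
    rw [wker_eq, wform]
    linear_combination (1 - kd i j) * ((early s j * early t j * hi) + early s i * hj
      - ((s : ℝ) - 1) / ((n : ℝ) - 2) * (early t j * hi + early t i * hj))
  have hss : ∀ i : Fin n, early s i * early s i = early s i := early_mul_early le_rfl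
  have htt : ∀ i : Fin n, early t i * early t i = early t i := early_mul_early le_rfl
  simp only [hfull, Finset.sum_sub_distrib, sum_mul_kd]
  simp only [Finset.sum_add_distrib, Finset.sum_sub_distrib, ← Finset.mul_sum, ← Finset.sum_mul,
    hss, htt, early_mul_early hst, fun i : Fin n => mul_comm (early t i) (early s i),
    sum_early ht, sum_early (hst.trans ht)]
  field_simp
  ring

end WeightedKernel

section PermutationCovariance

variable {n : ℕ}

lemma pexp_const_add {f W : Equiv.Perm (Fin n) → ℝ} {c : ℝ} (hf : ∀ σ, f σ = c + W σ)
    (hW : ∑ σ, W σ = 0) : pexp f = c := by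
  have : (n.factorial : ℝ) ≠ 0 := by exact_mod_cast n.factorial_ne_zero
  simp only [pexp, hf, Finset.sum_add_distrib, hW, add_zero, Finset.sum_const, Finset.card_univ,
    Fintype.card_perm, Fintype.card_fin, nsmul_eq_mul]
  field_simp

lemma pcov_const_add {f g W V : Equiv.Perm (Fin n) → ℝ} {c d : ℝ} (hf : ∀ σ, f σ = c + W σ)
    (hW : ∑ σ, W σ = 0) (hg : ∀ σ, g σ = d + V σ) (hV : ∑ σ, V σ = 0) :
    pcov f g = (∑ σ, W σ * V σ) / n.factorial := by
  simp only [pcov, pexp_const_add hf hW, pexp_const_add hg hV]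
  simp only [pexp, hf, hg, add_sub_cancel_left]

lemma pcov_comm (f g : Equiv.Perm (Fin n) → ℝ) : pcov f g = pcov g f := by
  simp only [pcov, mul_comm]

lemma pexp_standardize (f : Equiv.Perm (Fin n) → ℝ) (a : ℝ) :
    pexp (fun σ => (f σ - pexp f) / a) = 0 := by
  have : (n.factorial : ℝ) ≠ 0 := by exact_mod_cast n.factorial_ne_zero
  simp only [pexp, ← Finset.sum_div, Finset.sum_sub_distrib, Finset.sum_const, Finset.card_univ,
    Fintype.card_perm, Fintype.card_fin, nsmul_eq_mul]
  rw [mul_div_cancel_left₀ _ this]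
  simp

lemma pcov_standardize (f g : Equiv.Perm (Fin n) → ℝ) (a b : ℝ) :
    pcov (fun σ => (f σ - pexp f) / a) (fun σ => (g σ - pexp g) / b) = pcov f g / (a * b) := by
  rw [pcov, pexp_standardize, pexp_standardize, pcov]
  simp only [sub_zero, div_mul_div_comm]
  simp only [pexp, ← Finset.sum_div]
  ring

end PermutationCovariance

section EdgeCounts

variable {n ℓ : ℕ} (Gr : Finset (Sym2 (Node n ℓ)))

/-- Between-individual edge multiplicities. -/
def Dout (a b : Fin n) : ℝ := if a = b then 0 else (D Gr a b : ℝ)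

lemma Dout_symm (a b : Fin n) : Dout Gr a b = Dout Gr b a := by
  simp only [Dout, D, Sym2.eq_swap (a := a) (b := b), eq_comm (a := a)]

lemma Dout_self (a : Fin n) : Dout Gr a a = 0 := if_pos rfl

lemma sum_Dout_row (a : Fin n) : ∑ b, Dout Gr a b = Ddeg Gr a := by
  rw [Ddeg, Finset.sum_filter, Nat.cast_sum]
  refine Finset.sum_congr rfl fun b _ => ?_
  by_cases h : a = b
  · simp [Dout, h]
  · simp [Dout, h, Ne.symm h]

lemma sum_ordered_pairs {g : Fin n → Fin n → ℝ} (hg : ∀ a b, g a b = g b a) (p q : Fin n) :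
    ∑ a, ∑ b, (if a ≠ b ∧ s(p, q) = s(a, b) then g a b else 0) =
      if p = q then 0 else 2 * g p q := by
  by_cases hpq : p = q
  · subst hpq
    rw [if_pos rfl]
    refine Finset.sum_eq_zero fun a _ => Finset.sum_eq_zero fun b _ => if_neg ?_
    rintro ⟨hab, h⟩
    rcases Sym2.eq_iff.1 h with ⟨h1, h2⟩ | ⟨h1, h2⟩
    · exact hab (h1.symm.trans h2)
    · exact hab (h2.symm.trans h1)
  · rw [if_neg hpq]
    have : ∀ a b, (if a ≠ b ∧ s(p, q) = s(a, b) then g a b else 0) =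
        (kd p a * kd q b + kd q a * kd p b) * g p q := by
      intro a b
      simp only [kd, Sym2.eq_iff]
      by_cases h1 : p = a
      · subst h1
        by_cases h2 : q = b
        · subst h2; simp [hpq, Ne.symm hpq]
        · simp [h2, Ne.symm hpq]
      · by_cases h2 : q = a
        · subst h2
          by_cases h3 : p = b
          · subst h3; simp [hpq, Ne.symm hpq, hg q p]
          · simp [h1, h3]
        · simp [h1, h2]
    simp only [this, ← Finset.sum_mul, Finset.sum_add_distrib, ← Finset.mul_sum]
    have hk : ∀ i : Fin n, ∑ j, kd i j = 1 := fun i => by simp [kd]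
    simp only [hk]
    ring

lemma sum_Dout_mul {g : Fin n → Fin n → ℝ} (hg : ∀ a b, g a b = g b a)
    {φ : Sym2 (Node n ℓ) → ℝ} (hφ : ∀ x y : Node n ℓ, φ s(x, y) = g x.1 y.1) :
    ∑ a, ∑ b, Dout Gr a b * g a b = 2 * ∑ e ∈ Gout Gr, φ e := by
  have h : ∀ a b, Dout Gr a b * g a b =
      ∑ e ∈ Gr, if a ≠ b ∧ indPair e = s(a, b) then g a b else 0 := by
    intro a b
    by_cases hab : a = b
    · simp [Dout, hab]
    · simp only [Dout, hab, D, if_false, ne_eq, not_false_eq_true, true_and]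
      rw [← Finset.sum_filter, Finset.sum_const, nsmul_eq_mul]
  simp only [h]
  rw [Finset.sum_congr rfl fun a _ => Finset.sum_comm, Finset.sum_comm, Gout, Finset.sum_filter,
    Finset.mul_sum]
  refine Finset.sum_congr rfl fun e _ => ?_
  induction e with
  | _ x y =>
    change (∑ a, ∑ b, if a ≠ b ∧ s(x.1, y.1) = s(a, b) then g a b else 0) = _
    rw [sum_ordered_pairs hg x.1 y.1]
    simp only [indPair, Sym2.map_mk, Sym2.mk_isDiag_iff, hφ]
    split_ifs <;> simp

lemma sum_Dout : ∑ a, ∑ b, Dout Gr a b = 2 * (Gout Gr).card := by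
  have := sum_Dout_mul Gr (g := fun _ _ => 1) (fun _ _ => rfl) (φ := fun _ => 1) fun _ _ => rfl
  simpa using this

lemma le_sum_Dout_sq : 2 * ((Gout Gr).card : ℝ) ≤ ∑ a, ∑ b, Dout Gr a b ^ 2 := by
  rw [← sum_Dout]
  refine Finset.sum_le_sum fun a _ => Finset.sum_le_sum fun b _ => ?_
  unfold Dout
  split_ifs
  · simp
  · exact_mod_cast Nat.le_self_pow two_ne_zero _

lemma sum_Dout_early (t : ℕ) (σ : Equiv.Perm (Fin n)) :
    ∑ a, ∑ b, Dout Gr a b * (early t (σ a) * early t (σ b)) = 2 * Rout1 Gr t σ := by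
  rw [sum_Dout_mul Gr (fun a b => mul_comm _ _)
    (φ := fun e => if ∀ x ∈ e, (σ x.1 : ℕ) + 1 ≤ t then 1 else 0), Rout1, Finset.sum_boole]
  intro x y
  simp only [Sym2.mem_iff, forall_eq_or_imp, forall_eq, early, Nat.succ_le_iff]
  split_ifs <;> first | tauto | simp

lemma sum_Dout_late (t : ℕ) (σ : Equiv.Perm (Fin n)) :
    ∑ a, ∑ b, Dout Gr a b * ((1 - early t (σ a)) * (1 - early t (σ b))) =
      2 * Rout2 Gr t σ := by
  rw [sum_Dout_mul Gr (fun a b => mul_comm _ _)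
    (φ := fun e => if ∀ x ∈ e, t ≤ (σ x.1 : ℕ) then 1 else 0), Rout2, Finset.sum_boole]
  intro x y
  simp only [Sym2.mem_iff, forall_eq_or_imp, forall_eq, early, ← not_lt]
  split_ifs <;> first | tauto | simp

/-- The centered part of the weighted statistic. -/
def wcenter (t : ℕ) (σ : Equiv.Perm (Fin n)) : ℝ :=
  1 / 2 * ∑ a, ∑ b, Dout Gr a b * wker t (σ a) (σ b)

lemma Routw_eq (hn : 4 ≤ n) (t : ℕ) (σ : Equiv.Perm (Fin n)) :
    Routw Gr t σ = ((t : ℝ) - 1) * (n - t - 1) / ((n - 1) * (n - 2)) * (Gout Gr).card +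
      wcenter Gr t σ := by
  have hn' : (4 : ℝ) ≤ n := by exact_mod_cast hn
  have h1 : (n : ℝ) - 1 ≠ 0 := by linarith
  have h2 : (n : ℝ) - 2 ≠ 0 := by linarith
  have hterm : ∀ a b, Dout Gr a b * wker t (σ a) (σ b) =
      ((n : ℝ) - t - 1) / (n - 2) * (Dout Gr a b * (early t (σ a) * early t (σ b))) +
      ((t : ℝ) - 1) / (n - 2) * (Dout Gr a b * ((1 - early t (σ a)) * (1 - early t (σ b)))) -
      ((t : ℝ) - 1) * (n - t - 1) / ((n - 1) * (n - 2)) * Dout Gr a b := by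
    intro a b
    by_cases hab : a = b
    · rw [hab, Dout_self]; ring
    · rw [wker, if_neg (by simpa using hab), wform]
      field_simp
      ring
  simp only [wcenter, hterm, Finset.sum_add_distrib, Finset.sum_sub_distrib, ← Finset.mul_sum,
    sum_Dout_early, sum_Dout_late, sum_Dout, Routw]
  field_simp
  ring

lemma sum_wcenter (hn : 4 ≤ n) {t : ℕ} (ht : t ≤ n) : ∑ σ, wcenter Gr t σ = 0 := by
  simp only [wcenter]
  rw [← Finset.mul_sum, Finset.sum_comm]
  refine mul_eq_zero_of_right _ (Finset.sum_eq_zero fun a _ => ?_)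
  rw [Finset.sum_comm]
  refine Finset.sum_eq_zero fun b _ => ?_
  rw [← Finset.mul_sum]
  by_cases hab : a = b
  · rw [hab, Dout_self, zero_mul]
  · rw [sum_perm_linear (isCentered_wker hn ht) hab, mul_zero]

/-- The graph-dependent factor common to all covariances of the weighted statistic. -/
def covFactor : ℝ :=
  2 * (2 * ((Gout Gr).card : ℝ)) ^ 2 - 4 * ((n : ℝ) - 1) * ∑ a, (Ddeg Gr a : ℝ) ^ 2 +
    2 * (((n : ℝ) - 1) * (n - 2)) * ∑ a, ∑ b, Dout Gr a b ^ 2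

lemma pcov_Routw (hn : 4 ≤ n) {s t : ℕ} (hst : s ≤ t) (ht : t ≤ n) :
    pcov (Routw Gr s) (Routw Gr t) =
      covFactor Gr / (4 * ((n : ℝ) * (n - 1) * (n - 2) * (n - 3)) * ((n - 1) * (n - 2))) *
        ((s : ℝ) * (s - 1) * (n - t) * (n - t - 1)) := by
  have hn' : (4 : ℝ) ≤ n := by exact_mod_cast hn
  have h0 : (n : ℝ) ≠ 0 := by linarith
  have h1 : (n : ℝ) - 1 ≠ 0 := by linarith
  have h2 : (n : ℝ) - 2 ≠ 0 := by linarith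
  have h3 : (n : ℝ) - 3 ≠ 0 := by linarith
  have hfac : (n.factorial : ℝ) ≠ 0 := by exact_mod_cast n.factorial_ne_zero
  rw [pcov_const_add (Routw_eq Gr hn s) (sum_wcenter Gr hn (hst.trans ht))
    (Routw_eq Gr hn t) (sum_wcenter Gr hn ht)]
  have key := sum_perm_quadratic (isCentered_wker hn (hst.trans ht)) (isCentered_wker hn ht)
    (Dout_symm Gr) (Dout_self Gr) (by simpa using hn)
  rw [sum_Dout, sum_wker_mul_wker hn hst ht] at key
  simp only [Fintype.card_fin, sum_Dout_row] at key
  change _ = _ * covFactor Gr at key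
  have hsplit : ∀ σ, wcenter Gr s σ * wcenter Gr t σ = 1 / 4 *
      ((∑ a, ∑ b, Dout Gr a b * wker s (σ a) (σ b)) *
        ∑ c, ∑ d, Dout Gr c d * wker t (σ c) (σ d)) := fun σ => by
    simp only [wcenter]; ring
  rw [Finset.sum_congr rfl fun σ _ => hsplit σ, ← Finset.mul_sum]
  rw [mul_comm, ← eq_div_iff (by positivity)] at key
  rw [key]
  field_simp

lemma covFactor_pos {c C₁ C₂ : ℝ} (hn : 4 ≤ n) (hc : c * n ≤ (Gout Gr).card)
    (hC₁ : ((Gout Gr).card : ℝ) ≤ C₁ * n)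
    (hC₂ : ∑ a, (Ddeg Gr a : ℝ) ^ 2 - 4 * ((Gout Gr).card : ℝ) ^ 2 / n ≤ C₂ * n)
    (hlarge : 4 * C₁ ^ 2 + C₂ < c * (n - 2)) : 0 < covFactor Gr := by
  have hn' : (4 : ℝ) ≤ n := by exact_mod_cast hn
  have hpos : (0 : ℝ) < n := by linarith
  have hsq := le_sum_Dout_sq Gr
  have hm : 4 * ((Gout Gr).card : ℝ) ^ 2 / n ≤ 4 * C₁ ^ 2 * n := by
    rw [div_le_iff₀ hpos]
    have := pow_le_pow_left₀ (Nat.cast_nonneg _) hC₁ 2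
    nlinarith
  have hD : ∑ a, (Ddeg Gr a : ℝ) ^ 2 ≤ (4 * C₁ ^ 2 + C₂) * n := by linarith
  have hD' : ∑ a, (Ddeg Gr a : ℝ) ^ 2 < c * (n - 2) * n :=
    hD.trans_lt (mul_lt_mul_of_pos_right hlarge hpos)
  have hS : 2 * (c * n) * (n - 2) ≤ (∑ a, ∑ b, Dout Gr a b ^ 2) * (n - 2) :=
    mul_le_mul_of_nonneg_right (by linarith) (by linarith)
  have hdiff : 0 < (∑ a, ∑ b, Dout Gr a b ^ 2) * (n - 2) - 2 * ∑ a, (Ddeg Gr a : ℝ) ^ 2 := by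
    linarith
  have h4 : 0 < 2 * ((n : ℝ) - 1) := by linarith
  have h5 := mul_pos h4 hdiff
  rw [covFactor]
  have h6 : 0 ≤ 2 * (2 * ((Gout Gr).card : ℝ)) ^ 2 := by positivity
  linarith

end EdgeCounts

section Limit

/-- The shape of the covariance of the weighted statistic in rescaled times, up to a factor. -/
def covShape (ε p q : ℝ) : ℝ := p * (p - ε) * (1 - q) * (1 - q - ε)

lemma pcov_Zoutw {n ℓ : ℕ} {Gr : Finset (Sym2 (Node n ℓ))} (hn : 4 ≤ n) (hG : 0 < covFactor Gr)
    {s t : ℕ} (hst : s ≤ t) (ht : t ≤ n) :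
    pcov (Zoutw Gr s) (Zoutw Gr t) = covShape (1 / n) (s / n) (t / n) /
      (√(covShape (1 / n) (s / n) (s / n)) * √(covShape (1 / n) (t / n) (t / n))) := by
  have hn' : (4 : ℝ) ≤ n := by exact_mod_cast hn
  have h0 : (0 : ℝ) < n := by linarith
  have h1 : (0 : ℝ) < (n : ℝ) - 1 := by linarith
  have h2 : (0 : ℝ) < (n : ℝ) - 2 := by linarith
  have h3 : (0 : ℝ) < (n : ℝ) - 3 := by linarith
  obtain ⟨κ, hκ, hcov⟩ : ∃ κ : ℝ, 0 < κ ∧ ∀ s t : ℕ, s ≤ t → t ≤ n →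
      pcov (Routw Gr s) (Routw Gr t) = κ * covShape (1 / n) (s / n) (t / n) := by
    refine ⟨covFactor Gr / (4 * ((n : ℝ) * (n - 1) * (n - 2) * (n - 3)) * ((n - 1) * (n - 2))) *
      (n : ℝ) ^ 4, by positivity, fun s t hst ht => ?_⟩
    rw [pcov_Routw Gr hn hst ht, mul_assoc (covFactor Gr / _)]
    congr 1
    unfold covShape
    field_simp
  have : pcov (Zoutw Gr s) (Zoutw Gr t) = pcov (Routw Gr s) (Routw Gr t) /
      (√(pvar (Routw Gr s)) * √(pvar (Routw Gr t))) := pcov_standardize _ _ _ _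
  rw [this, pvar, pvar, hcov s t hst ht, hcov s s le_rfl (hst.trans ht), hcov t t le_rfl ht,
    Real.sqrt_mul hκ.le, Real.sqrt_mul hκ.le, mul_mul_mul_comm, Real.mul_self_sqrt hκ.le,
    mul_div_mul_left _ _ hκ.ne']

lemma tendsto_floor_mul_div {u : ℝ} (hu : 0 ≤ u) :
    Filter.Tendsto (fun n : ℕ => (⌊(n : ℝ) * u⌋₊ : ℝ) / n) Filter.atTop (nhds u) := by
  have := (tendsto_nat_floor_mul_div_atTop hu).comp (tendsto_natCast_atTop_atTop (R := ℝ))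
  simpa only [Function.comp_def, mul_comm u] using this

lemma tendsto_covShape {u v : ℝ} (hu : 0 ≤ u) (hv : 0 ≤ v) :
    Filter.Tendsto (fun n : ℕ =>
      covShape (1 / n) ((⌊(n : ℝ) * u⌋₊ : ℝ) / n) ((⌊(n : ℝ) * v⌋₊ : ℝ) / n))
      Filter.atTop (nhds (covShape 0 u v)) := by
  have he : Filter.Tendsto (fun n : ℕ => 1 / (n : ℝ)) Filter.atTop (nhds 0) :=
    tendsto_one_div_atTop_nhds_zero_nat
  have hs := tendsto_floor_mul_div hu
  have ht := tendsto_floor_mul_div hv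
  exact ((hs.mul (hs.sub he)).mul (ht.const_sub 1)).mul ((ht.const_sub 1).sub he)

lemma sqrt_covShape_zero {u : ℝ} (hu0 : 0 < u) (hu1 : u < 1) :
    √(covShape 0 u u) = u * (1 - u) := by
  rw [← Real.sqrt_sq (mul_nonneg hu0.le (sub_nonneg.2 hu1.le)), covShape]
  congr 1
  ring

lemma eventually_covFactor_pos {ℓ : ℕ} {Gr : ∀ n : ℕ, Finset (Sym2 (Node n ℓ))}
    (h1 : Cond1 ℓ Gr) (h2 : Cond2 ℓ Gr) : ∀ᶠ n in Filter.atTop, 0 < covFactor (Gr n) := by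
  obtain ⟨⟨c, C₁, hc, hm⟩, -⟩ := h1
  obtain ⟨⟨_, C₂, _, hD⟩, -⟩ := h2
  filter_upwards [hm, hD, Filter.eventually_ge_atTop 4,
    (tendsto_natCast_atTop_atTop (R := ℝ)).eventually_gt_atTop ((4 * C₁ ^ 2 + C₂) / c + 2)]
    with n hm hD hn hlarge
  refine covFactor_pos (Gr n) hn hm.1 hm.2 hD.2 ?_
  rw [← lt_sub_iff_add_lt, div_lt_iff₀ hc] at hlarge
  linarith

lemma tendsto_pcov_Zoutw {ℓ : ℕ} {Gr : ∀ n : ℕ, Finset (Sym2 (Node n ℓ))}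
    (h1 : Cond1 ℓ Gr) (h2 : Cond2 ℓ Gr) {u v : ℝ} (hu0 : 0 < u) (huv : u ≤ v) (hv1 : v < 1) :
    Filter.Tendsto
      (fun n : ℕ => pcov (Zoutw (Gr n) ⌊(n : ℝ) * u⌋₊) (Zoutw (Gr n) ⌊(n : ℝ) * v⌋₊))
      Filter.atTop (nhds (u * (1 - v) / (v * (1 - u)))) := by
  have hv0 := hu0.trans_le huv
  have hu1 := huv.trans_lt hv1
  have hden : √(covShape 0 u u) * √(covShape 0 v v) ≠ 0 := by
    rw [sqrt_covShape_zero hu0 hu1, sqrt_covShape_zero hv0 hv1]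
    have := sub_pos.2 hu1
    have := sub_pos.2 hv1
    positivity
  have hlim := (tendsto_covShape hu0.le hv0.le).div
    ((tendsto_covShape hu0.le hu0.le).sqrt.mul (tendsto_covShape hv0.le hv0.le).sqrt) hden
  have hval : covShape 0 u v / (√(covShape 0 u u) * √(covShape 0 v v)) =
      u * (1 - v) / (v * (1 - u)) := by
    rw [sqrt_covShape_zero hu0 hu1, sqrt_covShape_zero hv0 hv1, covShape]
    have := (sub_pos.2 hu1).ne'
    have := (sub_pos.2 hv1).ne'
    field_simp
    ring
  rw [hval] at hlim
  refine hlim.congr' ?_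
  filter_upwards [eventually_covFactor_pos h1 h2, Filter.eventually_ge_atTop 4] with n hG hn
  refine (pcov_Zoutw hn hG (Nat.floor_mono ?_) (Nat.floor_le_of_le ?_)).symm
  · gcongr
  · exact mul_le_of_le_one_right (Nat.cast_nonneg n) hv1.le

end Limit

/-- Limiting covariance function of the standardized weighted edge-count
process. -/
theorem cov_Zoutw_limit (ℓ : ℕ) (Gr : ∀ n : ℕ, Finset (Sym2 (Node n ℓ)))
    (hG : ∀ n, ∀ e ∈ Gr n, ¬ e.IsDiag)
    (h1 : Cond1 ℓ Gr) (h2 : Cond2 ℓ Gr) (h3 : Cond3 ℓ Gr)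
    (u v : ℝ) (hu0 : 0 < u) (hu1 : u < 1) (hv0 : 0 < v) (hv1 : v < 1) :
    Filter.Tendsto
      (fun n : ℕ => pcov (Zoutw (Gr n) ⌊(n : ℝ) * u⌋₊) (Zoutw (Gr n) ⌊(n : ℝ) * v⌋₊))
      Filter.atTop
      (nhds (min u v * (1 - max u v) / (max u v * (1 - min u v)))) := by
  rcases le_total u v with h | h
  · rw [min_eq_left h, max_eq_right h]
    exact tendsto_pcov_Zoutw h1 h2 hu0 h hv1
  · rw [min_eq_right h, max_eq_left h]
    simpa only [pcov_comm] using tendsto_pcov_Zoutw h1 h2 hv0 h hu1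

end CPD
end
end

section
/- Under Conditions 1–3, for all u, v with 0 < u, v < 1, the covariances of the standardized difference process and of the standardized within-individual process converge to the same limit: lim_{n→∞} Cov(Z_out,d([nu]), Z_out,d([nv])) = lim_{n→∞} Cov(Z_in([nu]), Z_in([nv])) = (u∧v)(1 − (u∨v)) / sqrt( (u∧v)(1 − (u∧v))·(u∨v)(1 − (u∨v)) ), where u∧v = min(u,v), u∨v = max(u,v), and [x] denotes the integer part of x. -/
open scoped BigOperators Classical

noncomputable section

namespace CPD

open Asymptotics

section

variable {n ℓ : ℕ}

theorem pexp_add (f g : Equiv.Perm (Fin n) → ℝ) :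
    pexp (fun σ => f σ + g σ) = pexp f + pexp g := by
  simp only [pexp, Finset.sum_add_distrib, add_div]

theorem pexp_const (k : ℝ) : pexp (fun _ : Equiv.Perm (Fin n) => k) = k := by
  have : (n.factorial : ℝ) ≠ 0 := by exact_mod_cast n.factorial_ne_zero
  simp only [pexp, Finset.sum_const, Finset.card_univ, Fintype.card_perm, Fintype.card_fin,
    nsmul_eq_mul]
  field_simp

theorem pexp_mul_left (k : ℝ) (f : Equiv.Perm (Fin n) → ℝ) :
    pexp (fun σ => k * f σ) = k * pexp f := by
  simp only [pexp, ← Finset.mul_sum, mul_div_assoc]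

theorem pexp_sum {ι : Type*} (S : Finset ι) (f : ι → Equiv.Perm (Fin n) → ℝ) :
    pexp (fun σ => ∑ i ∈ S, f i σ) = ∑ i ∈ S, pexp (f i) := by
  simp only [pexp, Finset.sum_comm (s := Finset.univ) (t := S), Finset.sum_div]

theorem pexp_mulRight (τ : Equiv.Perm (Fin n)) (f : Equiv.Perm (Fin n) → ℝ) :
    pexp (fun σ => f (σ * τ)) = pexp f := by
  simp only [pexp]
  congr 1
  exact Equiv.sum_comp (Equiv.mulRight τ) f

/-- The label of a single individual is uniformly distributed. -/
theorem pexp_apply (b : Fin n → ℝ) (i : Fin n) :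
    pexp (fun σ => b (σ i)) = (∑ j, b j) / n := by
  have hn : (n : ℝ) ≠ 0 := by
    have := i.pos
    positivity
  have hsymm : ∀ j, pexp (fun σ => b (σ j)) = pexp (fun σ => b (σ i)) := fun j => by
    rw [← pexp_mulRight (Equiv.swap i j) (fun σ => b (σ j))]
    simp
  have hsum : ∑ j, pexp (fun σ : Equiv.Perm (Fin n) => b (σ j)) = ∑ j, b j := by
    rw [← pexp_sum]
    simp only [Equiv.sum_comp, pexp_const]
  simp only [hsymm, Finset.sum_const, Finset.card_univ, Fintype.card_fin, nsmul_eq_mul] at hsum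
  rw [← hsum]
  field_simp

/-- Mixed second moments of the labels of two distinct individuals. -/
theorem pexp_apply_mul_apply_of_ne (b c : Fin n → ℝ) (hc : ∑ j, c j = 0) {i k : Fin n}
    (hik : i ≠ k) :
    pexp (fun σ => b (σ i) * c (σ k)) = -((∑ j, b j * c j) / n) / ((n : ℝ) - 1) := by
  have hn : (1 : ℝ) < n := by
    have : 1 < n := by
      have := i.isLt
      have := k.isLt
      have : (i : ℕ) ≠ k := fun h => hik (Fin.ext h)
      omega
    exact_mod_cast this
  have hsymm : ∀ j ∈ Finset.univ.erase i,
      pexp (fun σ => b (σ i) * c (σ j)) = pexp (fun σ => b (σ i) * c (σ k)) := fun j hj => by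
    rw [← pexp_mulRight (Equiv.swap k j) (fun σ => b (σ i) * c (σ j))]
    simp [Equiv.swap_apply_of_ne_of_ne hik (Finset.ne_of_mem_erase hj).symm]
  have hsum : ∑ j, pexp (fun σ : Equiv.Perm (Fin n) => b (σ i) * c (σ j)) = 0 := by
    rw [← pexp_sum]
    simp only [← Finset.mul_sum, Equiv.sum_comp, hc, mul_zero, pexp_const]
  rw [← Finset.add_sum_erase _ _ (Finset.mem_univ i), Finset.sum_congr rfl hsymm,
    pexp_apply (fun j => b j * c j) i, Finset.sum_const,
    Finset.card_erase_of_mem (Finset.mem_univ i), Finset.card_univ, Fintype.card_fin,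
    nsmul_eq_mul, Nat.cast_sub i.pos, Nat.cast_one] at hsum
  rw [eq_div_iff (by linarith)]
  linarith

theorem pexp_linear_mul_linear (a b c : Fin n → ℝ) (hc : ∑ j, c j = 0) (hn : 1 < n) :
    pexp (fun σ => (∑ i, a i * b (σ i)) * ∑ k, a k * c (σ k)) =
      ((∑ i, a i ^ 2) - (∑ i, a i) ^ 2 / n) / ((n : ℝ) - 1) * ∑ j, b j * c j := by
  have hn' : (1 : ℝ) < n := by exact_mod_cast hn
  have hpair : ∀ i k, pexp (fun σ : Equiv.Perm (Fin n) => a i * b (σ i) * (a k * c (σ k))) =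
      (∑ j, b j * c j) / n / ((n : ℝ) - 1) *
        ((if i = k then n * (a i * a k) else 0) - a i * a k) := fun i k => by
    have hmul : (fun σ : Equiv.Perm (Fin n) => a i * b (σ i) * (a k * c (σ k))) =
        fun σ => a i * a k * (b (σ i) * c (σ k)) := by
      ext σ
      ring
    have h0 : (n : ℝ) - 1 ≠ 0 := by linarith
    rw [hmul, pexp_mul_left]
    split_ifs with h
    · subst h
      rw [pexp_apply (fun j => b j * c j) i]
      field_simp
    · rw [pexp_apply_mul_apply_of_ne b c hc h]
      field_simp
      ring
  simp only [Finset.sum_mul_sum, pexp_sum, hpair]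
  simp only [← Finset.mul_sum, Finset.sum_sub_distrib, Finset.sum_ite_eq, Finset.mem_univ,
    if_true, ← Finset.sum_mul, ← sq]
  have h0 : (n : ℝ) - 1 ≠ 0 := by linarith
  field_simp

/-- Indicator of the labels that are at most `t`. -/
def prefixInd (n t : ℕ) (i : Fin n) : ℝ := if (i : ℕ) + 1 ≤ t then 1 else 0

theorem sum_prefixInd {t : ℕ} (ht : t ≤ n) : ∑ i, prefixInd n t i = t := by
  simp only [prefixInd, Nat.add_one_le_iff]
  rw [Fin.sum_univ_eq_sum_range (fun i => if i < t then (1 : ℝ) else 0) n, Finset.sum_boole]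
  have : (Finset.range n).filter (· < t) = Finset.range t := by
    ext i
    simp only [Finset.mem_filter, Finset.mem_range]
    omega
  rw [this, Finset.card_range]

theorem prefixInd_mul (s t : ℕ) (i : Fin n) :
    prefixInd n s i * prefixInd n t i = prefixInd n (min s t) i := by
  simp only [prefixInd, le_min_iff, ite_and, mul_ite, mul_zero, mul_one]
  split_ifs <;> rfl

/-- Covariances of affine statistics of the labels. -/
theorem pcov_affine (a : Fin n → ℝ) (k : ℝ) (hn : 1 < n) {s t : ℕ} (hs : s ≤ n) (ht : t ≤ n) :
    pcov (fun σ => ∑ i, a i * prefixInd n s (σ i) + k)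
        (fun σ => ∑ i, a i * prefixInd n t (σ i) + k) =
      ((∑ i, a i ^ 2) - (∑ i, a i) ^ 2 / n) / ((n : ℝ) - 1) *
        ((min s t : ℕ) - (s : ℝ) * t / n) := by
  have hn0 : (n : ℝ) ≠ 0 := by positivity
  have hcenter : ∀ r ≤ n, ∀ σ : Equiv.Perm (Fin n), ∑ i, a i * prefixInd n r (σ i) + k -
      pexp (fun τ : Equiv.Perm (Fin n) => ∑ i, a i * prefixInd n r (τ i) + k) =
      ∑ i, a i * (prefixInd n r (σ i) - r / n) := fun r hr σ => by
    rw [pexp_add, pexp_const, pexp_sum]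
    simp only [pexp_mul_left, pexp_apply, sum_prefixInd hr, mul_sub, Finset.sum_sub_distrib]
    ring
  have hmean : ∑ i, (prefixInd n t i - (t : ℝ) / n) = 0 := by
    rw [Finset.sum_sub_distrib, sum_prefixInd ht]
    simp only [Finset.sum_const, Finset.card_univ, Fintype.card_fin, nsmul_eq_mul]
    field_simp
    ring
  simp only [pcov, hcenter s hs, hcenter t ht]
  rw [pexp_linear_mul_linear a (fun j => prefixInd n s j - (s : ℝ) / n)
    (fun j => prefixInd n t j - (t : ℝ) / n) hmean hn]
  congr 1
  have hexpand : ∀ i : Fin n,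
      (prefixInd n s i - (s : ℝ) / n) * (prefixInd n t i - (t : ℝ) / n) =
      prefixInd n (min s t) i - (t : ℝ) / n * prefixInd n s i -
        (s : ℝ) / n * (prefixInd n t i - (t : ℝ) / n) := fun i => by
    rw [← prefixInd_mul]
    ring
  simp only [hexpand]
  rw [Finset.sum_sub_distrib, Finset.sum_sub_distrib, ← Finset.mul_sum, ← Finset.mul_sum, hmean,
    sum_prefixInd hs, sum_prefixInd (le_trans (min_le_left s t) hs)]
  ring

theorem pcov_standardized (f g : Equiv.Perm (Fin n) → ℝ) :
    pcov (fun σ => (f σ - pexp f) / Real.sqrt (pvar f))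
        (fun σ => (g σ - pexp g) / Real.sqrt (pvar g)) =
      pcov f g / (Real.sqrt (pvar f) * Real.sqrt (pvar g)) := by
  have hmean : ∀ (h : Equiv.Perm (Fin n) → ℝ) (r : ℝ),
      pexp (fun σ => (h σ - pexp h) / r) = 0 := fun h r => by
    have : (fun σ => (h σ - pexp h) / r) = fun σ => r⁻¹ * (h σ + -pexp h) := by
      ext σ
      ring
    rw [this, pexp_mul_left, pexp_add, pexp_const]
    ring
  rw [pcov, hmean, hmean, pcov, div_eq_inv_mul _ (_ * _), ← pexp_mul_left]
  congr 1
  ext σ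
  rw [sub_zero, sub_zero, mul_inv]
  ring

theorem mem_edge_forall_iff (p : Fin n → Prop) (e : Sym2 (Node n ℓ)) :
    (∀ x ∈ e, p x.1) ↔ ∀ i ∈ indPair e, p i := by
  simp [indPair, Sym2.mem_map]

theorem Ddeg_eq_sum (Gr : Finset (Sym2 (Node n ℓ))) (u : Fin n) :
    (Ddeg Gr u : ℝ) = ∑ e ∈ Gout Gr, if u ∈ indPair e then 1 else 0 := by
  have hedge : ∀ q : Sym2 (Fin n), (∑ v with v ≠ u, if q = s(u, v) then (1 : ℝ) else 0) =
      if ¬ q.IsDiag then (if u ∈ q then 1 else 0) else 0 := by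
    intro q
    by_cases hu : u ∈ q
    · obtain ⟨w, rfl⟩ := hu
      simp only [Sym2.congr_right, Sym2.mk_isDiag_iff, Sym2.mem_mk_left, if_true,
        Finset.sum_ite_eq, Finset.mem_filter, Finset.mem_univ, true_and]
      exact if_congr (by tauto) rfl rfl
    · rw [if_neg hu, ite_self]
      refine Finset.sum_eq_zero fun v _ => if_neg ?_
      rintro rfl
      exact hu (Sym2.mem_mk_left u v)
  simp only [Ddeg, D, Gout, Nat.cast_sum, Finset.card_filter, Finset.sum_filter (s := Gr)]
  push_cast
  rw [Finset.sum_comm]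
  exact Finset.sum_congr rfl fun e _ => hedge (indPair e)

theorem sum_indicator_mem_mul {q : Sym2 (Fin n)} (hq : ¬ q.IsDiag) (x : Fin n → ℝ) :
    ∃ i j, q = s(i, j) ∧ ∑ u, (if u ∈ q then 1 else 0) * x u = x i + x j := by
  induction q with
  | _ i j =>
    refine ⟨i, j, rfl, ?_⟩
    have hij : i ≠ j := hq
    have : ∀ u, (if u ∈ s(i, j) then 1 else 0) * x u =
        (if u = i then x u else 0) + if u = j then x u else 0 := fun u => by
      simp only [Sym2.mem_iff]
      by_cases h1 : u = i
      · subst h1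
        simp [hij]
      · simp [h1]
    simp only [this, Finset.sum_add_distrib, Finset.sum_ite_eq', Finset.mem_univ, if_true]

theorem sum_Ddeg (Gr : Finset (Sym2 (Node n ℓ))) :
    ∑ u, (Ddeg Gr u : ℝ) = 2 * (Gout Gr).card := by
  simp only [Ddeg_eq_sum]
  rw [Finset.sum_comm, mul_comm, ← nsmul_eq_mul, ← Finset.sum_const]
  refine Finset.sum_congr rfl fun e he => ?_
  obtain ⟨i, j, -, h⟩ := sum_indicator_mem_mul (Finset.mem_filter.1 he).2 (fun _ => 1)
  simp only [mul_one] at h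
  rw [h]
  norm_num

/-- The difference statistic is affine in the indicators of the labels. -/
theorem Routd_eq (Gr : Finset (Sym2 (Node n ℓ))) (t : ℕ) :
    Routd Gr t = fun σ =>
      ∑ u, (Ddeg Gr u : ℝ) * prefixInd n t (σ u) + -((Gout Gr).card : ℝ) := by
  ext σ
  simp only [Ddeg_eq_sum, Finset.sum_mul]
  rw [Finset.sum_comm]
  simp only [Routd, Rout1, Rout2, Finset.card_filter, Finset.card_eq_sum_ones (Gout Gr)]
  push_cast
  rw [← Finset.sum_sub_distrib, ← sub_eq_add_neg, ← Finset.sum_sub_distrib]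
  refine Finset.sum_congr rfl fun e he => ?_
  obtain ⟨i, j, hq, h⟩ := sum_indicator_mem_mul (Finset.mem_filter.1 he).2
    (fun u => prefixInd n t (σ u))
  rw [h]
  simp only [mem_edge_forall_iff (fun i => (σ i : ℕ) + 1 ≤ t) e,
    mem_edge_forall_iff (fun i => t ≤ (σ i : ℕ)) e, hq, Sym2.forall_mem_pair, prefixInd]
  split_ifs <;> first | omega | norm_num

theorem sum_indicator_eq_diag_mul {q : Sym2 (Fin n)} (hq : q.IsDiag) (x : Fin n → ℝ) :
    ∃ i, q = s(i, i) ∧ ∑ u, (if q = s(u, u) then 1 else 0) * x u = x i := by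
  induction q with
  | _ i j =>
    obtain rfl : i = j := hq
    exact ⟨i, rfl, by simp⟩

theorem D_self_eq_sum (Gr : Finset (Sym2 (Node n ℓ))) (u : Fin n) :
    (D Gr u u : ℝ) = ∑ e ∈ Gin Gr, if indPair e = s(u, u) then 1 else 0 := by
  rw [D, Finset.sum_boole, Gin, Finset.filter_filter]
  congr 2
  refine Finset.filter_congr fun e _ => ⟨fun h => ⟨?_, h⟩, fun h => h.2⟩
  rw [h]
  exact Sym2.diag_isDiag u

theorem sum_D_self (Gr : Finset (Sym2 (Node n ℓ))) :
    ∑ u, (D Gr u u : ℝ) = (Gin Gr).card := by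
  simp only [D_self_eq_sum]
  rw [Finset.sum_comm, Finset.card_eq_sum_ones, Nat.cast_sum]
  refine Finset.sum_congr rfl fun e he => ?_
  obtain ⟨i, -, h⟩ := sum_indicator_eq_diag_mul (Finset.mem_filter.1 he).2 (fun _ => 1)
  simp only [mul_one] at h
  rw [h, Nat.cast_one]

/-- The within-individual statistic is linear in the indicators of the labels. -/
theorem Rin1_eq (Gr : Finset (Sym2 (Node n ℓ))) (t : ℕ) :
    (fun σ => (Rin1 Gr t σ : ℝ)) = fun σ =>
      ∑ u, (D Gr u u : ℝ) * prefixInd n t (σ u) + 0 := by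
  ext σ
  simp only [D_self_eq_sum, Finset.sum_mul, add_zero]
  rw [Finset.sum_comm]
  simp only [Rin1, Finset.card_filter]
  push_cast
  refine Finset.sum_congr rfl fun e he => ?_
  obtain ⟨i, hq, h⟩ := sum_indicator_eq_diag_mul (Finset.mem_filter.1 he).2
    (fun u => prefixInd n t (σ u))
  rw [h]
  simp only [mem_edge_forall_iff (fun i => (σ i : ℕ) + 1 ≤ t) e, hq, Sym2.forall_mem_pair,
    prefixInd, and_self]

theorem tendsto_covariance_factor {u v : ℝ} (hu0 : 0 < u) (hv0 : 0 < v) :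
    Filter.Tendsto (fun n : ℕ =>
        (((min ⌊(n : ℝ) * u⌋₊ ⌊(n : ℝ) * v⌋₊ : ℕ) : ℝ) -
          (⌊(n : ℝ) * u⌋₊ : ℝ) * ⌊(n : ℝ) * v⌋₊ / n) / n)
      Filter.atTop (nhds (min u v - u * v)) := by
  have hfloor : ∀ {x : ℝ}, 0 < x →
      Filter.Tendsto (fun n : ℕ => (⌊(n : ℝ) * x⌋₊ : ℝ) / n) Filter.atTop (nhds x) :=
    fun {x} hx => by
      simpa only [mul_comm, Function.comp_def] using
        (tendsto_nat_floor_mul_div_atTop hx.le).comp tendsto_natCast_atTop_atTop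
  have hU := hfloor hu0
  have hV := hfloor hv0
  refine ((hU.min hV).sub (hU.mul hV)).congr fun n => ?_
  rw [Nat.cast_min, min_div_div_right (Nat.cast_nonneg n)]
  ring

theorem min_sub_mul_eq (u v : ℝ) : min u v - u * v = min u v * (1 - max u v) := by
  rw [← min_mul_max u v]
  ring

/-- The correlation function of a sequence of nondegenerate affine statistics of the labels. -/
theorem tendsto_pcov_standardized_affine (R : ∀ n : ℕ, ℕ → Equiv.Perm (Fin n) → ℝ)
    (a : ∀ n : ℕ, Fin n → ℝ) (k : ℕ → ℝ)
    (hR : ∀ n t, R n t = fun σ => ∑ i, a n i * prefixInd n t (σ i) + k n)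
    (hpos : ∀ᶠ n : ℕ in Filter.atTop, 0 < (∑ i, a n i ^ 2) - (∑ i, a n i) ^ 2 / n)
    {u v : ℝ} (hu0 : 0 < u) (hu1 : u < 1) (hv0 : 0 < v) (hv1 : v < 1) :
    Filter.Tendsto
      (fun n : ℕ => pcov
        (fun σ => (R n ⌊(n : ℝ) * u⌋₊ σ - pexp (R n ⌊(n : ℝ) * u⌋₊)) /
          Real.sqrt (pvar (R n ⌊(n : ℝ) * u⌋₊)))
        (fun σ => (R n ⌊(n : ℝ) * v⌋₊ σ - pexp (R n ⌊(n : ℝ) * v⌋₊)) /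
          Real.sqrt (pvar (R n ⌊(n : ℝ) * v⌋₊))))
      Filter.atTop
      (nhds (min u v * (1 - max u v) /
        Real.sqrt (min u v * (1 - min u v) * (max u v * (1 - max u v))))) := by
  have hu2 : 0 < u - u * u := by nlinarith
  have hv2 : 0 < v - v * v := by nlinarith
  have hlim : min u v * (1 - max u v) /
      Real.sqrt (min u v * (1 - min u v) * (max u v * (1 - max u v))) =
      (min u v - u * v) / (Real.sqrt (min u u - u * u) * Real.sqrt (min v v - v * v)) := by
    rw [min_self, min_self, ← Real.sqrt_mul hu2.le, ← min_sub_mul_eq]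
    congr 2
    rcases le_total u v with h | h
    · rw [min_eq_left h, max_eq_right h]
      ring
    · rw [min_eq_right h, max_eq_left h]
      ring
  have huu := tendsto_covariance_factor hu0 hu0
  have hvv := tendsto_covariance_factor hv0 hv0
  rw [hlim]
  refine ((tendsto_covariance_factor hu0 hv0).div (huu.sqrt.mul hvv.sqrt) ?_).congr' ?_
  · rw [min_self, min_self]
    positivity
  filter_upwards [hpos, Filter.eventually_gt_atTop 1] with n hV hn
  have hfloor : ∀ {x : ℝ}, x < 1 → ⌊(n : ℝ) * x⌋₊ ≤ n := fun {x} hx =>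
    Nat.floor_le_of_le (mul_le_of_le_one_right (Nat.cast_nonneg n) hx.le)
  have hn' : (1 : ℝ) < n := by exact_mod_cast hn
  have hcov : ∀ {x y : ℝ}, x < 1 → y < 1 →
      pcov (R n ⌊(n : ℝ) * x⌋₊) (R n ⌊(n : ℝ) * y⌋₊) =
      (n * (((∑ i, a n i ^ 2) - (∑ i, a n i) ^ 2 / n) / ((n : ℝ) - 1))) *
        ((((min ⌊(n : ℝ) * x⌋₊ ⌊(n : ℝ) * y⌋₊ : ℕ) : ℝ) -
          (⌊(n : ℝ) * x⌋₊ : ℝ) * ⌊(n : ℝ) * y⌋₊ / n) / n) := fun {x y} hx hy => by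
    rw [hR, hR, pcov_affine _ _ hn (hfloor hx) (hfloor hy)]
    field_simp
  have hc : 0 < n * (((∑ i, a n i ^ 2) - (∑ i, a n i) ^ 2 / n) / ((n : ℝ) - 1)) :=
    mul_pos (by linarith) (div_pos hV (by linarith))
  rw [pcov_standardized, pvar, pvar, hcov hu1 hu1, hcov hv1 hv1, hcov hu1 hv1,
    Real.sqrt_mul hc.le, Real.sqrt_mul hc.le, mul_mul_mul_comm, Real.mul_self_sqrt hc.le,
    mul_div_mul_left _ _ hc.ne']
  rfl

theorem SameOrder.eventually_pos {f : ℕ → ℝ} (h : SameOrder f fun n => (n : ℝ)) :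
    ∀ᶠ n in Filter.atTop, 0 < f n := by
  obtain ⟨c, C, hc, h⟩ := h
  filter_upwards [h, Filter.eventually_gt_atTop 0] with n hn hn0
  exact lt_of_lt_of_le (mul_pos hc (Nat.cast_pos.2 hn0)) hn.1

end

/-- The limiting covariance functions of the standardized difference process
and of the standardized within-individual process coincide. -/
theorem cov_Zoutd_Zin_limit (ℓ : ℕ) (Gr : ∀ n : ℕ, Finset (Sym2 (Node n ℓ)))
    (hG : ∀ n, ∀ e ∈ Gr n, ¬ e.IsDiag)
    (h1 : Cond1 ℓ Gr) (h2 : Cond2 ℓ Gr) (h3 : Cond3 ℓ Gr)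
    (u v : ℝ) (hu0 : 0 < u) (hu1 : u < 1) (hv0 : 0 < v) (hv1 : v < 1) :
    Filter.Tendsto
      (fun n : ℕ => pcov (Zoutd (Gr n) ⌊(n : ℝ) * u⌋₊) (Zoutd (Gr n) ⌊(n : ℝ) * v⌋₊))
      Filter.atTop
      (nhds (min u v * (1 - max u v) /
        Real.sqrt (min u v * (1 - min u v) * (max u v * (1 - max u v))))) ∧
    Filter.Tendsto
      (fun n : ℕ => pcov (Zin (Gr n) ⌊(n : ℝ) * u⌋₊) (Zin (Gr n) ⌊(n : ℝ) * v⌋₊))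
      Filter.atTop
      (nhds (min u v * (1 - max u v) /
        Real.sqrt (min u v * (1 - min u v) * (max u v * (1 - max u v))))) := by
  constructor
  · refine tendsto_pcov_standardized_affine (fun n => Routd (Gr n))
      (fun n i => (Ddeg (Gr n) i : ℝ)) _ (fun n => Routd_eq (Gr n)) ?_ hu0 hu1 hv0 hv1
    filter_upwards [h2.1.eventually_pos] with n hn
    rw [sum_Ddeg]
    convert hn using 2
    ring
  · refine tendsto_pcov_standardized_affine (fun n t σ => (Rin1 (Gr n) t σ : ℝ))
      (fun n i => (D (Gr n) i i : ℝ)) _ (fun n => Rin1_eq (Gr n)) ?_ hu0 hu1 hv0 hv1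
    filter_upwards [h2.2.eventually_pos] with n hn
    rw [sum_D_self]
    exact hn

end CPD
end
end
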